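/- arXiv:1101.5901 — 3 statements merged into one kernel-verified Lean document; each statement's English description precedes it below -/
import Mathlib

section
/- Let n ≥ 2, let A = Mat_{n×n}(ℂ), let r(u;y₁,y₂) be a unitary solution of the AYBE, and set s(u;y₁,y₂) = r(u;y₁,y₂)·r(−u;y₁,y₂) ∈ A⊗A. For complex numbers u₁,u₂,u₃ write u_{ij} = u_i − u_j. Then, at all parameter values where every factor below is defined, the following three expressions are equal: (I) r^{12}(u₁₂;y₁,y₂)·r^{13}(u₂₃;y₁,y₃)·r^{23}(u₁₂;y₂,y₃) − r^{23}(u₂₃;y₂,y₃)·r^{13}(u₁₂;y₁,y₃)·r^{12}(u₂₃;y₁,y₂); (II) s^{23}(u₂₃;y₂,y₃)·r^{13}(u₁₃;y₁,y₃) − r^{13}(u₁₃;y₁,y₃)·s^{23}(u₂₁;y₂,y₃); (III) r^{13}(u₁₃;y₁,y₃)·s^{12}(u₃₂;y₁,y₂) − s^{12}(u₁₂;y₁,y₂)·r^{13}(u₁₃;y₁,y₃). -/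
open Matrix Kronecker Filter Topology Set

noncomputable section

attribute [local instance] Matrix.normedAddCommGroup Matrix.normedSpace

abbrev Mat (n : ℕ) : Type := Matrix (Fin n) (Fin n) ℂ
abbrev T2 (n : ℕ) : Type := Matrix (Fin n × Fin n) (Fin n × Fin n) ℂ
abbrev T3 (n : ℕ) : Type := Matrix (Fin n × Fin n × Fin n) (Fin n × Fin n × Fin n) ℂ

/-- The embedding `t ↦ t^{12}` of `A ⊗ A` into `A ⊗ A ⊗ A`. -/
def emb12 {n : ℕ} (t : T2 n) : T3 n :=
  Matrix.of fun p q => t (p.1, p.2.1) (q.1, q.2.1) * (if p.2.2 = q.2.2 then 1 else 0)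

/-- The embedding `t ↦ t^{13}` of `A ⊗ A` into `A ⊗ A ⊗ A`. -/
def emb13 {n : ℕ} (t : T2 n) : T3 n :=
  Matrix.of fun p q => t (p.1, p.2.2) (q.1, q.2.2) * (if p.2.1 = q.2.1 then 1 else 0)

/-- The embedding `t ↦ t^{23}` of `A ⊗ A` into `A ⊗ A ⊗ A`. -/
def emb23 {n : ℕ} (t : T2 n) : T3 n :=
  Matrix.of fun p q => t (p.2.1, p.2.2) (q.2.1, q.2.2) * (if p.1 = q.1 then 1 else 0)

/-- The flip `t ↦ t^{21}` on `A ⊗ A`. -/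
def tflip {n : ℕ} (t : T2 n) : T2 n :=
  Matrix.of fun p q => t (p.2, p.1) (q.2, q.1)

/-- The associative Yang–Baxter equation with three spectral parameters. -/
def IsAYBESolution {n : ℕ} (r : ℂ → ℂ → ℂ → T2 n) : Prop :=
  ∀ u v y₁ y₂ y₃ : ℂ, u ≠ 0 → v ≠ 0 → u + v ≠ 0 → y₁ ≠ y₂ → y₁ ≠ y₃ → y₂ ≠ y₃ →
    emb12 (r u y₁ y₂) * emb23 (r (u + v) y₂ y₃) =
      emb13 (r (u + v) y₁ y₃) * emb12 (r (-v) y₁ y₂) + emb23 (r v y₂ y₃) * emb13 (r u y₁ y₃)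

/-- Unitarity: `r^{21}(-v; y₂, y₁) = - r(v; y₁, y₂)`. -/
def IsUnitarySolution {n : ℕ} (r : ℂ → ℂ → ℂ → T2 n) : Prop :=
  ∀ v y₁ y₂ : ℂ, v ≠ 0 → y₁ ≠ y₂ → tflip (r (-v) y₂ y₁) = - r v y₁ y₂

/-- `can : A ⊗ A → End(A)`, `X ⊗ Y ↦ (Z ↦ tr(XZ)·Y)`. -/
def canMap {n : ℕ} (t : T2 n) (Z : Mat n) : Mat n :=
  Matrix.of fun k l => ∑ i, ∑ j, t (i, k) (j, l) * Z j i

/-- Non-degeneracy: on a dense subset of the domain the tensor is invertible under `can`. -/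
def IsNonDegenerate {n : ℕ} (r : ℂ → ℂ → ℂ → T2 n) : Prop :=
  {p : ℂ × ℂ × ℂ | p.1 ≠ 0 ∧ p.2.1 ≠ p.2.2} ⊆
    closure {p : ℂ × ℂ × ℂ | p.1 ≠ 0 ∧ p.2.1 ≠ p.2.2 ∧
      Function.Bijective (canMap (r p.1 p.2.1 p.2.2))}

/-- `r` is holomorphic on `{(v,y₁,y₂) : v ≠ 0, y₁ ≠ y₂}`. -/
def IsHolomorphicOnDomain {n : ℕ} (r : ℂ → ℂ → ℂ → T2 n) : Prop :=
  DifferentiableOn ℂ (fun p : ℂ × ℂ × ℂ => r p.1 p.2.1 p.2.2)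
    {p : ℂ × ℂ × ℂ | p.1 ≠ 0 ∧ p.2.1 ≠ p.2.2}

/-- `r` is of the form (*): `r(v;y₁,y₂) = v⁻¹·1⊗1 + r₀(y₁,y₂) + v·r₁(y₁,y₂) + …`,
with Taylor coefficients `rc k`. -/
def HasLaurentForm {n : ℕ} (r : ℂ → ℂ → ℂ → T2 n) (rc : ℕ → ℂ → ℂ → T2 n) : Prop :=
  ∀ y₁ y₂ : ℂ, y₁ ≠ y₂ → ∃ ε > 0, ∀ v : ℂ, v ≠ 0 → ‖v‖ < ε →
    HasSum (fun k : ℕ => v ^ k • rc k y₁ y₂) (r v y₁ y₂ - v⁻¹ • 1)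

/-- `r` is meromorphic along the diagonal. -/
def IsMeromorphicAlongDiagonal {n : ℕ} (r : ℂ → ℂ → ℂ → T2 n) : Prop :=
  ∀ u : ℂ, u ≠ 0 → ∀ y₁ : ℂ, MeromorphicAt (fun y₂ => r u y₁ y₂) y₁

/-- `pr ⊗ id` on `A ⊗ A`, where `pr X = X - (tr X / n)·1`. -/
def prLeft {n : ℕ} (t : T2 n) : T2 n :=
  Matrix.of fun p q => t p q - if p.1 = q.1 then (∑ m, t (m, p.2) (m, q.2)) / (n : ℂ) else 0

/-- `id ⊗ pr` on `A ⊗ A`. -/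
def prRight {n : ℕ} (t : T2 n) : T2 n :=
  Matrix.of fun p q => t p q - if p.2 = q.2 then (∑ m, t (p.1, m) (q.1, m)) / (n : ℂ) else 0

/-- `pr ⊗ pr` on `A ⊗ A`. -/
def prTensorPr {n : ℕ} (t : T2 n) : T2 n := prLeft (prRight t)

/-- `c` has no infinitesimal symmetries: the only traceless `a` with
`[c(y₁,y₂), a⊗1 + 1⊗a] = 0` for all `y₁ ≠ y₂` is `a = 0`. -/
def HasNoInfinitesimalSymmetry {n : ℕ} (c : ℂ → ℂ → T2 n) : Prop :=
  ∀ a : Mat n, a.trace = 0 →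
    (∀ y₁ y₂ : ℂ, y₁ ≠ y₂ →
      c y₁ y₂ * (a ⊗ₖ (1 : Mat n) + (1 : Mat n) ⊗ₖ a) =
        (a ⊗ₖ (1 : Mat n) + (1 : Mat n) ⊗ₖ a) * c y₁ y₂) → a = 0

/-- The quantum Yang–Baxter equation. -/
def SatisfiesQYBE {n : ℕ} (q : ℂ → ℂ → T2 n) : Prop :=
  ∀ y₁ y₂ y₃ : ℂ, y₁ ≠ y₂ → y₁ ≠ y₃ → y₂ ≠ y₃ →
    emb12 (q y₁ y₂) * emb13 (q y₁ y₃) * emb23 (q y₂ y₃) =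
      emb23 (q y₂ y₃) * emb13 (q y₁ y₃) * emb12 (q y₁ y₂)

/-- The permutation tensor `P = Σ e_{ij} ⊗ e_{ji}`. -/
def Pmat (n : ℕ) : T2 n :=
  ∑ i : Fin n, ∑ j : Fin n,
    Matrix.single i j (1 : ℂ) ⊗ₖ Matrix.single j i (1 : ℂ)

/-- Relabel the tensor positions: swap of positions 2 and 3. -/
def sw23 (n : ℕ) : (Fin n × Fin n × Fin n) ≃ (Fin n × Fin n × Fin n) where
  toFun p := (p.1, p.2.2, p.2.1)
  invFun p := (p.1, p.2.2, p.2.1)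
  left_inv _ := rfl
  right_inv _ := rfl

/-- Swap of positions 1 and 2. -/
def sw12 (n : ℕ) : (Fin n × Fin n × Fin n) ≃ (Fin n × Fin n × Fin n) where
  toFun p := (p.2.1, p.1, p.2.2)
  invFun p := (p.2.1, p.1, p.2.2)
  left_inv _ := rfl
  right_inv _ := rfl

/-- Cyclic relabelling. -/
def cyc (n : ℕ) : (Fin n × Fin n × Fin n) ≃ (Fin n × Fin n × Fin n) where
  toFun p := (p.2.1, p.2.2, p.1)
  invFun p := (p.2.2, p.1, p.2.1)
  left_inv _ := rfl
  right_inv _ := rfl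

/-- Relabelling as an operation on `T3`. -/
def rel {n : ℕ} (e : (Fin n × Fin n × Fin n) ≃ (Fin n × Fin n × Fin n)) (X : T3 n) : T3 n :=
  X.submatrix e e

lemma rel_mul {n : ℕ} (e : (Fin n × Fin n × Fin n) ≃ (Fin n × Fin n × Fin n)) (X Y : T3 n) :
    rel e (X * Y) = rel e X * rel e Y :=
  (Matrix.submatrix_mul_equiv X Y e e e).symm

lemma rel_add {n : ℕ} (e : (Fin n × Fin n × Fin n) ≃ (Fin n × Fin n × Fin n)) (X Y : T3 n) :
    rel e (X + Y) = rel e X + rel e Y := rfl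

lemma sw23_12 {n : ℕ} (t : T2 n) : rel (sw23 n) (emb12 t) = emb13 t := rfl
lemma sw23_13 {n : ℕ} (t : T2 n) : rel (sw23 n) (emb13 t) = emb12 t := rfl
lemma sw23_23 {n : ℕ} (t : T2 n) : rel (sw23 n) (emb23 t) = emb23 (tflip t) := rfl
lemma sw12_12 {n : ℕ} (t : T2 n) : rel (sw12 n) (emb12 t) = emb12 (tflip t) := rfl
lemma sw12_13 {n : ℕ} (t : T2 n) : rel (sw12 n) (emb13 t) = emb23 t := rfl
lemma sw12_23 {n : ℕ} (t : T2 n) : rel (sw12 n) (emb23 t) = emb13 t := rfl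
lemma cyc_12 {n : ℕ} (t : T2 n) : rel (cyc n) (emb12 t) = emb23 t := rfl
lemma cyc_23 {n : ℕ} (t : T2 n) : rel (cyc n) (emb23 t) = emb13 (tflip t) := rfl
lemma cyc_13 {n : ℕ} (t : T2 n) : rel (cyc n) (emb13 t) = emb12 (tflip t) := rfl

lemma emb12_neg {n : ℕ} (t : T2 n) : emb12 (-t) = -emb12 t := by
  ext p q; simp only [emb12, Matrix.of_apply, Matrix.neg_apply, neg_mul]
lemma emb13_neg {n : ℕ} (t : T2 n) : emb13 (-t) = -emb13 t := by
  ext p q; simp only [emb13, Matrix.of_apply, Matrix.neg_apply, neg_mul]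
lemma emb23_neg {n : ℕ} (t : T2 n) : emb23 (-t) = -emb23 t := by
  ext p q; simp only [emb23, Matrix.of_apply, Matrix.neg_apply, neg_mul]

lemma emb23_eq {n : ℕ} (t : T2 n) : emb23 t = (1 : Mat n) ⊗ₖ t := by
  ext p q; simp [emb23, Matrix.one_apply, Matrix.kroneckerMap_apply]

lemma emb23_mul {n : ℕ} (t t' : T2 n) : emb23 (t * t') = emb23 t * emb23 t' := by
  rw [emb23_eq, emb23_eq, emb23_eq, ← Matrix.mul_kronecker_mul, one_mul]

lemma emb13_mul {n : ℕ} (t t' : T2 n) : emb13 (t * t') = emb13 t * emb13 t' := by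
  rw [← sw12_23, emb23_mul, rel_mul, sw12_23, sw12_23]

lemma emb12_mul {n : ℕ} (t t' : T2 n) : emb12 (t * t') = emb12 t * emb12 t' := by
  rw [← sw23_13, emb13_mul, rel_mul, sw23_13, sw23_13]

/-- For a unitary solution `r` of the AYBE and
`s(u;y₁,y₂) = r(u;y₁,y₂)·r(−u;y₁,y₂)`, the three expressions (I), (II), (III) coincide. -/
theorem qybe_defect_identities (n : ℕ) (hn : 2 ≤ n)
    (r : ℂ → ℂ → ℂ → T2 n)
    (hAYBE : IsAYBESolution r) (hUnit : IsUnitarySolution r)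
    (s : ℂ → ℂ → ℂ → T2 n) (hs : ∀ u y₁ y₂ : ℂ, s u y₁ y₂ = r u y₁ y₂ * r (-u) y₁ y₂) :
    ∀ u₁ u₂ u₃ y₁ y₂ y₃ : ℂ, u₁ ≠ u₂ → u₁ ≠ u₃ → u₂ ≠ u₃ → y₁ ≠ y₂ → y₁ ≠ y₃ → y₂ ≠ y₃ →
      (emb12 (r (u₁ - u₂) y₁ y₂) * emb13 (r (u₂ - u₃) y₁ y₃) * emb23 (r (u₁ - u₂) y₂ y₃) -
          emb23 (r (u₂ - u₃) y₂ y₃) * emb13 (r (u₁ - u₂) y₁ y₃) * emb12 (r (u₂ - u₃) y₁ y₂) =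
        emb23 (s (u₂ - u₃) y₂ y₃) * emb13 (r (u₁ - u₃) y₁ y₃) -
          emb13 (r (u₁ - u₃) y₁ y₃) * emb23 (s (u₂ - u₁) y₂ y₃)) ∧
      (emb23 (s (u₂ - u₃) y₂ y₃) * emb13 (r (u₁ - u₃) y₁ y₃) -
          emb13 (r (u₁ - u₃) y₁ y₃) * emb23 (s (u₂ - u₁) y₂ y₃) =
        emb13 (r (u₁ - u₃) y₁ y₃) * emb12 (s (u₃ - u₂) y₁ y₂) -
          emb12 (s (u₁ - u₂) y₁ y₂) * emb13 (r (u₁ - u₃) y₁ y₃)) := by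
  intro u₁ u₂ u₃ y₁ y₂ y₃ h12 h13 h23 hy12 hy13 hy23
  obtain ⟨a, ha⟩ : ∃ a, a = u₁ - u₂ := ⟨_, rfl⟩
  obtain ⟨b, hb⟩ : ∃ b, b = u₂ - u₃ := ⟨_, rfl⟩
  have ha0 : a ≠ 0 := by rw [ha]; exact sub_ne_zero.2 h12
  have hb0 : b ≠ 0 := by rw [hb]; exact sub_ne_zero.2 h23
  have hab : u₁ - u₃ = a + b := by rw [ha, hb]; ring
  have hab0 : a + b ≠ 0 := by rw [← hab]; exact sub_ne_zero.2 h13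
  have hna : u₂ - u₁ = -a := by rw [ha]; ring
  have hnb : u₃ - u₂ = -b := by rw [hb]; ring
  rw [hna, hnb, hab, ← ha, ← hb]
  -- unitarity in the form used below
  have U : ∀ v z w : ℂ, v ≠ 0 → z ≠ w → tflip (r v w z) = -r (-v) z w := by
    intro v z w hv hz
    have := hUnit (-v) z w (neg_ne_zero.2 hv) hz
    rwa [neg_neg] at this
  have E1 := congrArg (rel (sw23 n)) (hAYBE (a + b) (-b) y₁ y₃ y₂ hab0 (neg_ne_zero.2 hb0)
    (by simpa using ha0) hy13 hy12 hy23.symm)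
  have E2 := congrArg (rel (cyc n)) (hAYBE (-b) (-a) y₂ y₃ y₁ (neg_ne_zero.2 hb0)
    (neg_ne_zero.2 ha0) (by rw [← neg_add_rev]; exact neg_ne_zero.2 hab0)
    hy23 hy12.symm hy13.symm)
  have E3 := congrArg (rel (sw12 n)) (hAYBE a b y₂ y₁ y₃ ha0 hb0 hab0 hy12.symm hy23 hy13)
  have E4 := hAYBE a b y₁ y₂ y₃ ha0 hb0 hab0 hy12 hy13 hy23
  have hs1 : a + b + -b = a := by ring
  have hs2 : -b + -a = -(a + b) := by ring
  have nb0 := neg_ne_zero.2 hb0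
  have na0 := neg_ne_zero.2 ha0
  have nab0 := neg_ne_zero.2 hab0
  rw [hs1] at E1
  rw [hs2] at E2
  simp only [rel_mul, rel_add, sw23_12, sw23_13, sw23_23, neg_neg] at E1
  simp only [rel_mul, rel_add, cyc_12, cyc_13, cyc_23, neg_neg] at E2
  simp only [rel_mul, rel_add, sw12_12, sw12_13, sw12_23] at E3
  rw [U a y₂ y₃ ha0 hy23, U (-b) y₂ y₃ nb0 hy23, neg_neg, emb23_neg, emb23_neg] at E1
  rw [U (-(a + b)) y₁ y₃ nab0 hy13, U (-(a + b)) y₁ y₂ nab0 hy12, U (-a) y₁ y₃ na0 hy13,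
    U (-b) y₁ y₂ nb0 hy12] at E2
  simp only [neg_neg, emb12_neg, emb13_neg] at E2
  rw [U a y₁ y₂ ha0 hy12, U (-b) y₁ y₂ nb0 hy12] at E3
  simp only [neg_neg, emb12_neg] at E3
  simp only [hs, emb12_mul, emb23_mul, neg_neg]
  generalize emb12 (r a y₁ y₂) = A12 at *
  generalize emb12 (r (-a) y₁ y₂) = A12' at *
  generalize emb12 (r b y₁ y₂) = B12 at *
  generalize emb12 (r (-b) y₁ y₂) = B12' at *
  generalize emb12 (r (a + b) y₁ y₂) = C12 at *
  generalize emb13 (r a y₁ y₃) = A13 at *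
  generalize emb13 (r b y₁ y₃) = B13 at *
  generalize emb13 (r (a + b) y₁ y₃) = C13 at *
  generalize emb23 (r a y₂ y₃) = A23 at *
  generalize emb23 (r (-a) y₂ y₃) = A23' at *
  generalize emb23 (r b y₂ y₃) = B23 at *
  generalize emb23 (r (-b) y₂ y₃) = B23' at *
  generalize emb23 (r (a + b) y₂ y₃) = C23 at *
  have F1 : A12 * B13 = B23 * C12 - C13 * A23' := by
    have := E1; simp only [neg_mul, mul_neg] at this; grind
  have F2 : A13 * B12 = C12 * A23 - B23' * C13 := by
    have := E2; simp only [neg_mul, mul_neg] at this; grind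
  have F3 : B13 * A23 = C23 * B12 - A12' * C13 := by
    have := E3; simp only [neg_mul, mul_neg] at this; grind
  have F4 : B23 * A13 = A12 * C23 - C13 * B12' := by
    rw [E4]; noncomm_ring
  have I2 : A12 * B13 * A23 - B23 * A13 * B12 = B23 * B23' * C13 - C13 * (A23' * A23) := by
    rw [F1, mul_assoc B23 A13, F2]; noncomm_ring
  have I3 : A12 * B13 * A23 - B23 * A13 * B12 = C13 * (B12' * B12) - A12 * A12' * C13 := by
    rw [mul_assoc A12, F3, F4]; noncomm_ring
  exact ⟨I2, I2.symm.trans I3⟩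
end
end

section
/- Let n ≥ 2, let A = Mat_{n×n}(ℂ), and let r(v;y₁,y₂) be a non-degenerate solution of the AYBE. If a ∈ sl_n(ℂ) satisfies [r(v;y₁,y₂), 1⊗a] = 0 for all v ≠ 0 and y₁ ≠ y₂, then a = 0. -/
open Matrix Kronecker Filter Topology Set

noncomputable section

attribute [local instance] Matrix.normedAddCommGroup Matrix.normedSpace

theorem canMap_mul_right_aux {n : ℕ} (t : T2 n) (a Z : Mat n) :
    canMap (t * ((1 : Mat n) ⊗ₖ a)) Z = canMap t Z * a := by
  ext k l
  simp only [canMap, Matrix.of_apply, Matrix.mul_apply, Fintype.sum_prod_type,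
    Matrix.kroneckerMap_apply, Matrix.one_apply, ite_mul, one_mul, zero_mul, mul_ite, mul_zero]
  have h : ∀ i j : Fin n, (∑ x, ∑ m, if x = j then t (i, k) (x, m) * a m l else 0) * Z j i
      = ∑ m, t (i, k) (j, m) * Z j i * a m l := by
    intro i j
    rw [Finset.sum_comm]
    simp only [Finset.sum_ite_eq', Finset.mem_univ, if_true, Finset.sum_mul]
    exact Finset.sum_congr rfl fun m _ => by ring
  simp only [h]
  simp only [Finset.sum_mul]
  rw [Finset.sum_congr rfl fun i _ => Finset.sum_comm, Finset.sum_comm]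

theorem canMap_mul_left_aux {n : ℕ} (t : T2 n) (a Z : Mat n) :
    canMap (((1 : Mat n) ⊗ₖ a) * t) Z = a * canMap t Z := by
  ext k l
  simp only [canMap, Matrix.of_apply, Matrix.mul_apply, Fintype.sum_prod_type,
    Matrix.kroneckerMap_apply, Matrix.one_apply, ite_mul, one_mul, zero_mul, Finset.mul_sum]
  have h : ∀ i j : Fin n, (∑ x, ∑ m, if i = x then a k m * t (x, m) (j, l) else 0) * Z j i
      = ∑ m, a k m * (t (i, m) (j, l) * Z j i) := by
    intro i j
    rw [Finset.sum_comm]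
    simp only [Finset.sum_ite_eq, Finset.mem_univ, if_true, Finset.sum_mul]
    exact Finset.sum_congr rfl fun m _ => by ring
  simp only [h]
  rw [Finset.sum_congr rfl fun i _ => Finset.sum_comm, Finset.sum_comm]

/-- If `r` is a non-degenerate solution of the AYBE and `a ∈ sl_n(ℂ)`
satisfies `[r(v;y₁,y₂), 1⊗a] = 0` for all `v ≠ 0`, `y₁ ≠ y₂`, then `a = 0`. -/
theorem commuting_traceless_is_zero (n : ℕ) (hn : 2 ≤ n)
    (r : ℂ → ℂ → ℂ → T2 n)
    (hAYBE : IsAYBESolution r) (hND : IsNonDegenerate r)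
    (a : Mat n) (ha : a.trace = 0)
    (hcomm : ∀ v y₁ y₂ : ℂ, v ≠ 0 → y₁ ≠ y₂ →
      r v y₁ y₂ * ((1 : Mat n) ⊗ₖ a) = ((1 : Mat n) ⊗ₖ a) * r v y₁ y₂) :
    a = 0 := by
  have hne : ((1 : ℂ), (0 : ℂ), (1 : ℂ)) ∈ {p : ℂ × ℂ × ℂ | p.1 ≠ 0 ∧ p.2.1 ≠ p.2.2} := by
    simp
  obtain ⟨⟨v, y₁, y₂⟩, hv, hy, hbij⟩ := closure_nonempty_iff.mp ⟨_, hND hne⟩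
  have hc := hcomm v y₁ y₂ hv hy
  have hcent : ∀ X : Mat n, X * a = a * X := by
    intro X
    obtain ⟨Z, rfl⟩ := hbij.2 X
    rw [← canMap_mul_left_aux, ← canMap_mul_right_aux, hc]
  obtain ⟨c, rfl⟩ : a ∈ Set.range (Matrix.scalar (Fin n)) :=
    Matrix.mem_range_scalar_of_commute_single fun i j _ => hcent _
  have hn0 : (n : ℂ) ≠ 0 := by
    exact_mod_cast (by omega : n ≠ 0)
  have hc0 : c = 0 := by
    simpa [Matrix.trace, hn0] using ha
  simp [hc0]
end
end

section
/- Let A = Mat_{2×2}(ℂ), let e_{ij} ∈ A be the matrix units, ȟ = diag(1/2, −1/2), and P = Σ_{1≤i,j≤2} e_{ij}⊗e_{ji} ∈ A⊗A. Define, for v ≠ 0 and y₁ ≠ y₂, r_{(2,1)}(v;y₁,y₂) = (1/(2v))·1⊗1 + (1/(y₂−y₁))·P + (v−y₁)·e₂₁⊗ȟ + (v+y₂)·ȟ⊗e₂₁ − (v(v−y₁)(v+y₂)/2)·e₂₁⊗e₂₁. Then r_{(2,1)} is a non-degenerate unitary solution of the AYBE. -/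
open Matrix Kronecker Filter Topology Set

noncomputable section

attribute [local instance] Matrix.normedAddCommGroup Matrix.normedSpace

/-- `e₂₁ ∈ Mat₂(ℂ)`. -/
def e21 : Mat 2 := Matrix.single 1 0 (1 : ℂ)

/-- `ȟ = diag(1/2, −1/2)`. -/
def hcheck : Mat 2 := Matrix.diagonal ![(1 : ℂ) / 2, -(1 / 2)]

/-- The solution `r_{(2,1)}`. -/
def r21sol (v y₁ y₂ : ℂ) : T2 2 :=
  (1 / (2 * v)) • ((1 : Mat 2) ⊗ₖ (1 : Mat 2)) + (1 / (y₂ - y₁)) • Pmat 2 +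
    (v - y₁) • (e21 ⊗ₖ hcheck) + (v + y₂) • (hcheck ⊗ₖ e21) -
    (v * (v - y₁) * (v + y₂) / 2) • (e21 ⊗ₖ e21)

/-- Explicit entries of `r21sol`. -/
def rEntry (v a b : ℂ) (i k j l : Fin 2) : ℂ :=
  !![!![1 / (2 * v) + 1 / (b - a), 0; (v + b) / 2, 1 / (2 * v)],
     !![0, 0; 1 / (b - a), 0];
     !![(v - a) / 2, 1 / (b - a); -(v * (v - a) * (v + b) / 2), -((v - a) / 2)],
     !![1 / (2 * v), 0; -((v + b) / 2), 1 / (2 * v) + 1 / (b - a)]] i j k l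

lemma r21sol_entry (v a b : ℂ) (i k j l : Fin 2) :
    r21sol v a b (i, k) (j, l) = rEntry v a b i k j l := by
  fin_cases i <;> fin_cases k <;> fin_cases j <;> fin_cases l <;>
    simp [r21sol, rEntry, Pmat, e21, hcheck, Fin.sum_univ_two, Matrix.single_apply,
      Matrix.one_apply, Matrix.add_apply, Matrix.sub_apply] <;> try ring

lemma r21sol_unitary : IsUnitarySolution r21sol := by
  intro v a b hv hab
  have h1 : b - a ≠ 0 := sub_ne_zero.mpr hab.symm
  have h2 : a - b ≠ 0 := sub_ne_zero.mpr hab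
  ext ⟨i, k⟩ ⟨j, l⟩
  simp only [tflip, Matrix.of_apply, Matrix.neg_apply, r21sol_entry]
  fin_cases i <;> fin_cases k <;> fin_cases j <;> fin_cases l <;>
    simp [rEntry] <;> grind

lemma r21sol_bij (v a b : ℂ) (hv : v ≠ 0) (hab : a ≠ b) (h : v ≠ a - b) :
    Function.Bijective (canMap (r21sol v a b)) := by
  have h1 : b - a ≠ 0 := sub_ne_zero.mpr hab.symm
  let L : Mat 2 →ₗ[ℂ] Mat 2 :=
    { toFun := canMap (r21sol v a b)
      map_add' := by
        intro X Y; ext k l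
        simp [canMap, Fin.sum_univ_two]; ring
      map_smul' := by
        intro c X; ext k l
        simp [canMap, Fin.sum_univ_two]; ring }
  have hinj : Function.Injective L := by
    rw [injective_iff_map_eq_zero]
    intro Z hZ
    have e : ∀ k l, canMap (r21sol v a b) Z k l = 0 := fun k l => congrFun (congrFun hZ k) l
    have e00 := e 0 0
    have e01 := e 0 1
    have e10 := e 1 0
    have e11 := e 1 1
    simp [canMap, Fin.sum_univ_two, r21sol_entry, rEntry] at e00 e01 e10 e11
    have z01 : Z 0 1 = 0 := by grind
    rw [z01] at e00 e10 e11
    have hd : Z 0 0 = Z 1 1 := by grind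
    have z00 : Z 0 0 = 0 := by
      rw [← hd] at e00
      have : (v + b - a) * Z 0 0 = 0 := by
        field_simp at e00
        linear_combination e00 / 2
      rcases mul_eq_zero.mp this with hz | hz
      · exact absurd (by linear_combination hz) h
      · exact hz
    have z11 : Z 1 1 = 0 := hd ▸ z00
    rw [z00, z11] at e10
    have z10 : Z 1 0 = 0 := by grind
    ext i j
    fin_cases i <;> fin_cases j <;> simp [*]
  exact ⟨hinj, LinearMap.injective_iff_surjective.mp hinj⟩

lemma r21sol_nondeg : IsNonDegenerate r21sol := by
  rintro ⟨v, a, b⟩ ⟨hv, hab⟩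
  simp only at hv hab
  have ht : Tendsto (fun t : ℂ => (t, a, b)) (𝓝[≠] v) (𝓝 (v, a, b)) :=
    ((by fun_prop : Continuous (fun t : ℂ => (t, a, b))).tendsto v).mono_left nhdsWithin_le_nhds
  refine mem_closure_of_tendsto ht ?_
  have e1 : ∀ᶠ t in 𝓝[≠] v, t ≠ 0 := nhdsWithin_le_nhds (isOpen_ne.mem_nhds hv)
  have e2 : ∀ᶠ t in 𝓝[≠] v, t ≠ a - b := by
    by_cases h : v = a - b
    · rw [← h]; exact self_mem_nhdsWithin
    · exact nhdsWithin_le_nhds (isOpen_ne.mem_nhds h)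
  filter_upwards [e1, e2] with t h1 h2
  exact ⟨h1, hab, r21sol_bij t a b h1 hab h2⟩

set_option maxHeartbeats 4000000 in
lemma r21sol_aybe : IsAYBESolution r21sol := by
  intro u v a b c hu hv huv hab hac hbc
  have h1 : b - a ≠ 0 := sub_ne_zero.mpr hab.symm
  have h2 : c - a ≠ 0 := sub_ne_zero.mpr hac.symm
  have h3 : c - b ≠ 0 := sub_ne_zero.mpr hbc.symm
  ext ⟨i, j, k⟩ ⟨l, m, n⟩
  simp only [Matrix.mul_apply, Matrix.add_apply, emb12, emb13, emb23, Matrix.of_apply,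
    Fintype.sum_prod_type, Fin.sum_univ_two, r21sol_entry]
  fin_cases i <;> fin_cases j <;> fin_cases k <;> fin_cases l <;> fin_cases m <;>
    fin_cases n <;> simp [rEntry] <;> field_simp <;> ring

/-- `r_{(2,1)}` is a non-degenerate unitary solution of the AYBE. -/
theorem r21sol_is_nondeg_unitary_aybe :
    IsAYBESolution r21sol ∧ IsUnitarySolution r21sol ∧ IsNonDegenerate r21sol := by
  exact ⟨r21sol_aybe, r21sol_unitary, r21sol_nondeg⟩
end
end
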